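/- arXiv:2003.03478 — 4 statements merged into one kernel-verified Lean document; each statement's English description precedes it below -/
import Mathlib

section
/- There exists a constant C > 0, depending only on L, such that for all smooth Ω-periodic functions f, g, h : ℝ³ → ℝ one has ∫_Ω |f g h| dx dy dz ≤ C (‖f‖₂ + ‖∇_h f‖₂)^{1/2} (‖f‖₂ + ‖∂_z f‖₂)^{1/2} ‖g‖₂^{1/2} (‖g‖₂ + ‖∇_h g‖₂)^{1/2} ‖h‖₂. -/
noncomputable section
open Real

/-- `f` is periodic with period `2πL` in the first two variables and `2π` in the third. -/
def OmegaPeriodic (L : ℝ) (f : ℝ → ℝ → ℝ → ℝ) : Prop :=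
  (∀ x y z, f (x + 2*π*L) y z = f x y z) ∧
  (∀ x y z, f x (y + 2*π*L) z = f x y z) ∧
  (∀ x y z, f x y (z + 2*π) = f x y z)

/-- Smoothness of a function of three real variables. -/
def Smooth3 (f : ℝ → ℝ → ℝ → ℝ) : Prop :=
  ContDiff ℝ (⊤ : ℕ∞) (fun p : ℝ × ℝ × ℝ => f p.1 p.2.1 p.2.2)

/-- Integral over the fundamental domain `Ω = [0,2πL]² × [0,2π]`. -/
def intOmega (L : ℝ) (g : ℝ → ℝ → ℝ → ℝ) : ℝ :=
  ∫ z in (0:ℝ)..(2*π), ∫ y in (0:ℝ)..(2*π*L), ∫ x in (0:ℝ)..(2*π*L), g x y z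

/-- The `L²(Ω)` norm. -/
def l2norm (L : ℝ) (f : ℝ → ℝ → ℝ → ℝ) : ℝ :=
  Real.sqrt (intOmega L (fun x y z => (f x y z)^2))

def pdx (f : ℝ → ℝ → ℝ → ℝ) (x y z : ℝ) : ℝ := deriv (fun s => f s y z) x
def pdy (f : ℝ → ℝ → ℝ → ℝ) (x y z : ℝ) : ℝ := deriv (fun s => f x s z) y
def pdz (f : ℝ → ℝ → ℝ → ℝ) (x y z : ℝ) : ℝ := deriv (fun s => f x y s) z

/-- The `L²(Ω)` norm of the horizontal gradient `∇_h f = (∂_x f, ∂_y f)`. -/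
def gradHnorm (L : ℝ) (f : ℝ → ℝ → ℝ → ℝ) : ℝ :=
  Real.sqrt (intOmega L (fun x y z => (pdx f x y z)^2 + (pdy f x y z)^2))

/-- The `L²(Ω)` norm of the vertical derivative `∂_z f`. -/
def pdznorm (L : ℝ) (f : ℝ → ℝ → ℝ → ℝ) : ℝ :=
  Real.sqrt (intOmega L (fun x y z => (pdz f x y z)^2))

open MeasureTheory Set

/-- Lebesgue measure on `[0, P]`. -/
abbrev segMeasure (P : ℝ) : Measure ℝ := volume.restrict (Icc 0 P)

/-- Lebesgue measure on `[0, P]²`. -/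
abbrev squareMeasure (P : ℝ) : Measure (ℝ × ℝ) := (segMeasure P).prod (segMeasure P)

/-- Lebesgue measure on `[0, Q] × [0, P]²`. -/
abbrev boxMeasure (Q P : ℝ) : Measure (ℝ × ℝ × ℝ) := (segMeasure Q).prod (squareMeasure P)

lemma squareMeasure_eq (P : ℝ) :
    squareMeasure P = volume.restrict (Icc 0 P ×ˢ Icc 0 P) :=
  Measure.prod_restrict _ _

lemma boxMeasure_eq (Q P : ℝ) :
    boxMeasure Q P = volume.restrict (Icc 0 Q ×ˢ Icc 0 P ×ˢ Icc 0 P) := by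
  rw [boxMeasure, squareMeasure_eq]
  exact Measure.prod_restrict _ _

lemma integrable_segMeasure (P : ℝ) {u : ℝ → ℝ} (hu : Continuous u) :
    Integrable u (segMeasure P) :=
  hu.continuousOn.integrableOn_compact isCompact_Icc

lemma integrable_squareMeasure (P : ℝ) {u : ℝ × ℝ → ℝ} (hu : Continuous u) :
    Integrable u (squareMeasure P) := by
  rw [squareMeasure_eq]
  exact hu.continuousOn.integrableOn_compact (isCompact_Icc.prod isCompact_Icc)

lemma integrable_boxMeasure (Q P : ℝ) {u : ℝ × ℝ × ℝ → ℝ} (hu : Continuous u) :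
    Integrable u (boxMeasure Q P) := by
  rw [boxMeasure_eq]
  exact hu.continuousOn.integrableOn_compact
    (isCompact_Icc.prod (isCompact_Icc.prod isCompact_Icc))

lemma continuous_integral_squareMeasure (P : ℝ) {u : ℝ × ℝ × ℝ → ℝ} (hu : Continuous u) :
    Continuous fun z => ∫ q, u (z, q) ∂squareMeasure P := by
  rw [squareMeasure_eq]
  exact continuous_parametric_integral_of_continuous (f := fun z q => u (z, q)) hu
    (isCompact_Icc.prod isCompact_Icc)

/-- The Cauchy–Schwarz inequality, for a function dominated by a geometric mean. -/
lemma sq_integral_le_of_sq_le_mul {X : Type*} [MeasurableSpace X] {μ : Measure X}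
    {a p q : X → ℝ} (ha : Integrable a μ) (hp : Integrable p μ) (hq : Integrable q μ)
    (hp0 : ∀ x, 0 ≤ p x) (hq0 : ∀ x, 0 ≤ q x) (h : ∀ᵐ x ∂μ, a x ^ 2 ≤ p x * q x) :
    (∫ x, a x ∂μ) ^ 2 ≤ (∫ x, p x ∂μ) * ∫ x, q x ∂μ := by
  have key : ∀ t : ℝ, 0 ≤ (∫ x, p x ∂μ) * (t * t) + 2 * (∫ x, a x ∂μ) * t + ∫ x, q x ∂μ := by
    intro t
    have e : (∫ x, p x ∂μ) * (t * t) + 2 * (∫ x, a x ∂μ) * t + ∫ x, q x ∂μ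
        = ∫ x, (p x * (t * t) + a x * (2 * t) + q x) ∂μ := by
      have i := (hp.mul_const (t * t)).add (ha.mul_const (2 * t))
      rw [integral_add (f := fun x => p x * (t * t) + a x * (2 * t)) i hq,
        integral_add (hp.mul_const _) (ha.mul_const _), integral_mul_const, integral_mul_const]
      ring
    rw [e]
    refine integral_nonneg_of_ae (h.mono fun x hx => ?_)
    have h1 := hp0 x
    have h2 := hq0 x
    rcases h1.eq_or_lt with h0 | h0
    · rw [← h0] at hx
      have : a x = 0 := by nlinarith
      simp [← h0, this, h2]
    · have : 0 ≤ p x * (p x * (t * t) + a x * (2 * t) + q x) := by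
        nlinarith [sq_nonneg (p x * t + a x)]
      exact nonneg_of_mul_nonneg_right this h0
  have := discrim_le_zero key
  rw [discrim] at this
  linarith

lemma abs_le_integral_add_deriv {P : ℝ} (hP : 0 < P) {u u' : ℝ → ℝ}
    (hu : ∀ x, HasDerivAt u (u' x) x) (hu' : Continuous u') {x : ℝ} (hx : x ∈ Icc 0 P) :
    |u x| ≤ ∫ t, (P⁻¹ * |u t| + |u' t|) ∂segMeasure P := by
  have huc : Continuous u := continuous_iff_continuousAt.2 fun x => (hu x).continuousAt
  have i1 := integrable_segMeasure P huc.abs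
  have i2 := integrable_segMeasure P hu'.abs
  set W := ∫ t, |u' t| ∂segMeasure P with hW
  have key : ∀ t ∈ Icc 0 P, |u x| ≤ |u t| + W := by
    intro t ht
    have h1 : ∫ s in t..x, u' s = u x - u t :=
      intervalIntegral.integral_eq_sub_of_hasDerivAt (fun s _ => hu s)
        (hu'.intervalIntegrable _ _)
    have h2 : |u x - u t| ≤ W := by
      rw [← h1]
      refine (intervalIntegral.norm_integral_le_integral_norm_uIoc (f := u')).trans ?_
      refine setIntegral_mono_set i2 (ae_of_all _ fun s => abs_nonneg _)
        (LE.le.eventuallyLE ?_)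
      exact uIoc_subset_uIcc.trans (uIcc_subset_Icc ht hx)
    have := abs_sub_abs_le_abs_sub (u x) (u t)
    linarith
  have hvol : (segMeasure P).real univ = P := by simp [hP.le]
  have h3 : ∫ _t, |u x| ∂segMeasure P ≤ ∫ t, (|u t| + W) ∂segMeasure P :=
    setIntegral_mono_on (integrable_segMeasure P continuous_const)
      (integrable_segMeasure P (by fun_prop)) measurableSet_Icc key
  rw [integral_const, integral_add i1 (integrable_segMeasure P continuous_const),
    integral_const, hvol, smul_eq_mul, smul_eq_mul] at h3
  rw [integral_add (i1.const_mul _) i2, integral_const_mul, ← hW]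
  have : P⁻¹ * (P * |u x|) ≤ P⁻¹ * ((∫ t, |u t| ∂segMeasure P) + P * W) := by gcongr
  rw [mul_add, inv_mul_cancel_left₀ hP.ne', inv_mul_cancel_left₀ hP.ne'] at this
  exact this

lemma ae_mem_squareMeasure (P : ℝ) :
    ∀ᵐ q ∂squareMeasure P, q.1 ∈ Icc 0 P ∧ q.2 ∈ Icc 0 P := by
  rw [squareMeasure_eq]
  exact ae_restrict_mem (measurableSet_Icc.prod measurableSet_Icc)

/-- The Gagliardo–Nirenberg–Sobolev embedding `W^{1,1} ⊆ L²` on a square. -/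
lemma integral_sq_le_integral_mul_integral {P : ℝ} (hP : 0 < P) {w w₁ w₂ : ℝ × ℝ → ℝ}
    (h₁ : ∀ q : ℝ × ℝ, HasDerivAt (fun s => w (s, q.2)) (w₁ q) q.1)
    (h₂ : ∀ q : ℝ × ℝ, HasDerivAt (fun s => w (q.1, s)) (w₂ q) q.2)
    (hw : Continuous w) (hw₁ : Continuous w₁) (hw₂ : Continuous w₂) :
    ∫ q, w q ^ 2 ∂squareMeasure P ≤
      (∫ q, (P⁻¹ * |w q| + |w₁ q|) ∂squareMeasure P) *
        ∫ q, (P⁻¹ * |w q| + |w₂ q|) ∂squareMeasure P := by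
  have c₁ : Continuous fun q => P⁻¹ * |w q| + |w₁ q| := by fun_prop
  have c₂ : Continuous fun q => P⁻¹ * |w q| + |w₂ q| := by fun_prop
  have i₁ := integrable_squareMeasure P c₁
  have i₂ := integrable_squareMeasure P c₂
  rw [integral_prod_symm _ i₁, integral_prod _ i₂, mul_comm, ← integral_prod_mul]
  refine integral_mono_ae (integrable_squareMeasure P (by fun_prop))
    (i₂.integral_prod_left.mul_prod i₁.integral_prod_right) ?_
  filter_upwards [ae_mem_squareMeasure P] with q hq
  have e₁ : |w q| ≤ _ := abs_le_integral_add_deriv hP (u := fun s => w (s, q.2))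
    (u' := fun s => w₁ (s, q.2)) (fun s => h₁ (s, q.2)) (by fun_prop) hq.1
  have e₂ : |w q| ≤ _ := abs_le_integral_add_deriv hP (u := fun s => w (q.1, s))
    (u' := fun s => w₂ (q.1, s)) (fun s => h₂ (q.1, s)) (by fun_prop) hq.2
  rw [← sq_abs, sq]
  exact mul_le_mul e₂ e₁ (abs_nonneg _) ((abs_nonneg _).trans e₂)

lemma sq_add_abs_pow_le (c a b e : ℝ) (m : ℕ) (he : 0 ≤ e) :
    (c * |a ^ (m + 1)| + |(m + 1 : ℝ) * a ^ m * b|) ^ 2 ≤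
      a ^ (2 * m) * ((2 * c ^ 2 + 2 * (m + 1 : ℝ) ^ 2) * (a ^ 2 + (b ^ 2 + e))) := by
  have h : (c * |a ^ (m + 1)| + |(m + 1 : ℝ) * a ^ m * b|) ^ 2 =
      a ^ (2 * m) * (c * |a| + (m + 1) * |b|) ^ 2 := by
    rw [pow_mul', ← sq_abs (a ^ m), abs_mul, abs_mul, pow_succ a, abs_mul,
      abs_of_nonneg (by positivity : (0 : ℝ) ≤ m + 1)]
    ring
  rw [h]
  have : 0 ≤ a ^ (2 * m) := by rw [pow_mul']; positivity
  gcongr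
  nlinarith [sq_nonneg (c * |a| - (m + 1) * |b|), sq_abs a, sq_abs b,
    mul_nonneg (sq_nonneg c) (sq_nonneg b), mul_nonneg (sq_nonneg c) he,
    mul_nonneg (sq_nonneg (m + 1 : ℝ)) (sq_nonneg a), mul_nonneg (sq_nonneg (m + 1 : ℝ)) he]

lemma mul_le_of_sq_le_of_sq_le {a b c : ℝ} (ha : a ^ 2 ≤ c) (hb : b ^ 2 ≤ c) : a * b ≤ c := by
  nlinarith [sq_nonneg (a - b)]

/-- `‖u‖_{2m+2}^{2m+2} ≤ K ‖u‖_{2m}^{2m} ‖u‖_{H¹}²` on a square. -/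
lemma integral_pow_le_integral_pow_mul {P : ℝ} (hP : 0 < P) (m : ℕ) {u u₁ u₂ : ℝ × ℝ → ℝ}
    (h₁ : ∀ q : ℝ × ℝ, HasDerivAt (fun s => u (s, q.2)) (u₁ q) q.1)
    (h₂ : ∀ q : ℝ × ℝ, HasDerivAt (fun s => u (q.1, s)) (u₂ q) q.2)
    (hu : Continuous u) (hu₁ : Continuous u₁) (hu₂ : Continuous u₂) :
    ∫ q, u q ^ (2 * (m + 1)) ∂squareMeasure P ≤
      (∫ q, u q ^ (2 * m) ∂squareMeasure P) *
        ((2 * P⁻¹ ^ 2 + 2 * (m + 1 : ℝ) ^ 2) *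
          ∫ q, (u q ^ 2 + (u₂ q ^ 2 + u₁ q ^ 2)) ∂squareMeasure P) := by
  have h := integral_sq_le_integral_mul_integral hP (w := fun q => u q ^ (m + 1))
    (w₁ := fun q => (m + 1 : ℝ) * u q ^ m * u₁ q) (w₂ := fun q => (m + 1 : ℝ) * u q ^ m * u₂ q)
    (fun q => by simpa using (h₁ q).fun_pow (m + 1))
    (fun q => by simpa using (h₂ q).fun_pow (m + 1))
    (by fun_prop) (by fun_prop) (by fun_prop)
  simp only [← pow_mul'] at h
  refine h.trans ?_
  rw [← integral_const_mul (2 * P⁻¹ ^ 2 + 2 * (m + 1 : ℝ) ^ 2)]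
  have cs : ∀ v : ℝ × ℝ → ℝ, Continuous v →
      (∀ q, v q ^ 2 ≤ u₂ q ^ 2 + u₁ q ^ 2) →
      (∫ q, (P⁻¹ * |u q ^ (m + 1)| + |(m + 1 : ℝ) * u q ^ m * v q|) ∂squareMeasure P) ^ 2 ≤
        (∫ q, u q ^ (2 * m) ∂squareMeasure P) * ∫ q, (2 * P⁻¹ ^ 2 + 2 * (m + 1 : ℝ) ^ 2) *
          (u q ^ 2 + (u₂ q ^ 2 + u₁ q ^ 2)) ∂squareMeasure P := by
    intro v hv hle
    refine sq_integral_le_of_sq_le_mul (integrable_squareMeasure P (by fun_prop))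
      (integrable_squareMeasure P (by fun_prop)) (integrable_squareMeasure P (by fun_prop))
      (fun q => by rw [pow_mul']; positivity) (fun q => by positivity) (ae_of_all _ fun q => ?_)
    have := sq_add_abs_pow_le P⁻¹ (u q) (v q) (u₂ q ^ 2 + u₁ q ^ 2 - v q ^ 2) m
      (sub_nonneg.2 (hle q))
    rwa [add_sub_cancel] at this
  have b₁ := cs u₁ hu₁ fun q => by nlinarith [sq_nonneg (u₂ q)]
  have b₂ := cs u₂ hu₂ fun q => by nlinarith [sq_nonneg (u₁ q)]
  exact mul_le_of_sq_le_of_sq_le b₁ b₂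

lemma sq_integral_pow_four_le {P Q : ℝ} (hQ : 0 < Q) {f f₀ : ℝ × ℝ × ℝ → ℝ}
    (h₀ : ∀ p : ℝ × ℝ × ℝ, HasDerivAt (fun s => f (s, p.2)) (f₀ p) p.1)
    (hf : Continuous f) (hf₀ : Continuous f₀) {z : ℝ} (hz : z ∈ Icc 0 Q) :
    (∫ q, f (z, q) ^ 4 ∂squareMeasure P) ^ 2 ≤ (∫ p, f p ^ 6 ∂boxMeasure Q P) *
      ((2 * Q⁻¹ ^ 2 + 32) * ∫ p, (f p ^ 2 + f₀ p ^ 2) ∂boxMeasure Q P) := by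
  set a : ℝ × ℝ × ℝ → ℝ := fun p => Q⁻¹ * |f p ^ 4| + |4 * f p ^ 3 * f₀ p| with ha
  have ac : Continuous a := by fun_prop
  have ia := integrable_boxMeasure Q P ac
  have h1 : ∫ q, f (z, q) ^ 4 ∂squareMeasure P ≤ ∫ p, a p ∂boxMeasure Q P := by
    rw [integral_prod_symm _ ia]
    refine integral_mono (integrable_squareMeasure P (by fun_prop)) ia.integral_prod_right
      fun q => ?_
    refine (le_abs_self _).trans (abs_le_integral_add_deriv hQ (u := fun s => f (s, q) ^ 4)
      (u' := fun s => 4 * f (s, q) ^ 3 * f₀ (s, q)) (fun s => ?_) (by fun_prop) hz)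
    simpa using (h₀ (s, q)).fun_pow 4
  have h0 : 0 ≤ ∫ q, f (z, q) ^ 4 ∂squareMeasure P := integral_nonneg fun q => by positivity
  refine (pow_le_pow_left₀ h0 h1 2).trans ?_
  rw [← integral_const_mul]
  refine sq_integral_le_of_sq_le_mul ia (integrable_boxMeasure Q P (by fun_prop))
    (integrable_boxMeasure Q P (by fun_prop)) (fun q => by positivity) (fun q => by positivity)
    (ae_of_all _ fun p => ?_)
  have := sq_add_abs_pow_le Q⁻¹ (f p) (f₀ p) 0 3 le_rfl
  norm_num [ha] at this ⊢
  exact this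

/-- The trace estimate `‖f‖_{L^∞_z L⁴_h}⁴ ≤ K (‖f‖² + ‖∇_h f‖²) (‖f‖² + ‖∂_z f‖²)` on a box. -/
lemma integral_pow_four_le {P Q : ℝ} (hP : 0 < P) (hQ : 0 < Q)
    {f f₀ f₁ f₂ : ℝ × ℝ × ℝ → ℝ}
    (h₀ : ∀ p : ℝ × ℝ × ℝ, HasDerivAt (fun s => f (s, p.2)) (f₀ p) p.1)
    (h₁ : ∀ p : ℝ × ℝ × ℝ, HasDerivAt (fun s => f (p.1, s, p.2.2)) (f₁ p) p.2.1)
    (h₂ : ∀ p : ℝ × ℝ × ℝ, HasDerivAt (fun s => f (p.1, p.2.1, s)) (f₂ p) p.2.2)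
    (hf : Continuous f) (hf₀ : Continuous f₀) (hf₁ : Continuous f₁) (hf₂ : Continuous f₂)
    {z : ℝ} (hz : z ∈ Icc 0 Q) :
    ∫ q, f (z, q) ^ 4 ∂squareMeasure P ≤ (2 * P⁻¹ ^ 2 + 18) * (2 * Q⁻¹ ^ 2 + 32) *
      (∫ p, (f p ^ 2 + (f₂ p ^ 2 + f₁ p ^ 2)) ∂boxMeasure Q P) *
      ∫ p, (f p ^ 2 + f₀ p ^ 2) ∂boxMeasure Q P := by
  have cN : Continuous fun z => ∫ q, f (z, q) ^ 4 ∂squareMeasure P :=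
    continuous_integral_squareMeasure P (u := fun p => f p ^ 4) (by fun_prop)
  have hH : Continuous fun p => f p ^ 2 + (f₂ p ^ 2 + f₁ p ^ 2) := by fun_prop
  have cH := continuous_integral_squareMeasure P hH
  have h6 : Continuous fun p => f p ^ 6 := by fun_prop
  obtain ⟨z₀, hz₀, hmax⟩ := isCompact_Icc.exists_isMaxOn ⟨z, hz⟩ cN.continuousOn
  refine (show _ ≤ ∫ q, f (z₀, q) ^ 4 ∂squareMeasure P from hmax hz).trans ?_
  have hS := sq_integral_pow_four_le (P := P) hQ h₀ hf hf₀ hz₀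
  set M := ∫ q, f (z₀, q) ^ 4 ∂squareMeasure P with hM
  set V := ∫ p, (f p ^ 2 + f₀ p ^ 2) ∂boxMeasure Q P
  have hV : 0 ≤ V := integral_nonneg fun p => by positivity
  set H := ∫ p, (f p ^ 2 + (f₂ p ^ 2 + f₁ p ^ 2)) ∂boxMeasure Q P with hHdef
  have hH0 : 0 ≤ H := integral_nonneg fun p => by positivity
  have hM0 : 0 ≤ M := integral_nonneg fun p => by positivity
  have hL6 : ∫ p, f p ^ 6 ∂boxMeasure Q P ≤ M * ((2 * P⁻¹ ^ 2 + 18) * H) := by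
    rw [integral_prod _ (integrable_boxMeasure Q P h6), hHdef,
      integral_prod _ (integrable_boxMeasure Q P hH), ← integral_const_mul, ← integral_const_mul]
    refine setIntegral_mono_on
      (integrable_segMeasure Q (continuous_integral_squareMeasure P h6))
      (integrable_segMeasure Q ((cH.const_mul _).const_mul _)) measurableSet_Icc fun t ht => ?_
    have := integral_pow_le_integral_pow_mul hP 2 (u := fun q => f (t, q))
      (fun q => h₁ (t, q)) (fun q => h₂ (t, q)) (by fun_prop) (by fun_prop) (by fun_prop)
    norm_num at this
    norm_num
    refine this.trans (mul_le_mul_of_nonneg_right (hmax ht) ?_)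
    exact mul_nonneg (by positivity) (integral_nonneg fun q => by positivity)
  have hfin : M * M ≤ M * ((2 * P⁻¹ ^ 2 + 18) * (2 * Q⁻¹ ^ 2 + 32) * H * V) := by
    calc M * M = M ^ 2 := (sq M).symm
      _ ≤ _ := hS
      _ ≤ M * ((2 * P⁻¹ ^ 2 + 18) * H) * ((2 * Q⁻¹ ^ 2 + 32) * V) := by gcongr
      _ = _ := by ring
  rcases hM0.eq_or_lt with h | h
  · rw [← h]; positivity
  · exact le_of_mul_le_mul_left hfin h

lemma pow_four_integral_abs_mul_le {P Q : ℝ} (hP : 0 < P) (hQ : 0 < Q)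
    {f f₀ f₁ f₂ g g₁ g₂ h : ℝ × ℝ × ℝ → ℝ}
    (h₀ : ∀ p : ℝ × ℝ × ℝ, HasDerivAt (fun s => f (s, p.2)) (f₀ p) p.1)
    (h₁ : ∀ p : ℝ × ℝ × ℝ, HasDerivAt (fun s => f (p.1, s, p.2.2)) (f₁ p) p.2.1)
    (h₂ : ∀ p : ℝ × ℝ × ℝ, HasDerivAt (fun s => f (p.1, p.2.1, s)) (f₂ p) p.2.2)
    (hf : Continuous f) (hf₀ : Continuous f₀) (hf₁ : Continuous f₁) (hf₂ : Continuous f₂)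
    (k₁ : ∀ p : ℝ × ℝ × ℝ, HasDerivAt (fun s => g (p.1, s, p.2.2)) (g₁ p) p.2.1)
    (k₂ : ∀ p : ℝ × ℝ × ℝ, HasDerivAt (fun s => g (p.1, p.2.1, s)) (g₂ p) p.2.2)
    (hg : Continuous g) (hg₁ : Continuous g₁) (hg₂ : Continuous g₂) (hh : Continuous h) :
    (∫ p, |f p * g p * h p| ∂boxMeasure Q P) ^ 4 ≤
      ((2 * P⁻¹ ^ 2 + 18) * (2 * Q⁻¹ ^ 2 + 32) * (2 * P⁻¹ ^ 2 + 8)) *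
      (∫ p, (f p ^ 2 + (f₂ p ^ 2 + f₁ p ^ 2)) ∂boxMeasure Q P) *
      (∫ p, (f p ^ 2 + f₀ p ^ 2) ∂boxMeasure Q P) * (∫ p, g p ^ 2 ∂boxMeasure Q P) *
      (∫ p, (g p ^ 2 + (g₂ p ^ 2 + g₁ p ^ 2)) ∂boxMeasure Q P) *
      (∫ p, h p ^ 2 ∂boxMeasure Q P) ^ 2 := by
  have cfg : Continuous fun p => (f p * g p) ^ 2 := by fun_prop
  have cg : Continuous fun p => g p ^ 2 := by fun_prop
  have cE : Continuous fun p => g p ^ 2 + (g₂ p ^ 2 + g₁ p ^ 2) := by fun_prop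
  have hI : (∫ p, |f p * g p * h p| ∂boxMeasure Q P) ^ 2 ≤
      (∫ p, (f p * g p) ^ 2 ∂boxMeasure Q P) * ∫ p, h p ^ 2 ∂boxMeasure Q P :=
    sq_integral_le_of_sq_le_mul (integrable_boxMeasure Q P (by fun_prop))
      (integrable_boxMeasure Q P cfg) (integrable_boxMeasure Q P (by fun_prop))
      (fun p => by positivity) (fun p => by positivity)
      (ae_of_all _ fun p => by rw [sq_abs, mul_pow])
  set M := (2 * P⁻¹ ^ 2 + 18) * (2 * Q⁻¹ ^ 2 + 32) *
      (∫ p, (f p ^ 2 + (f₂ p ^ 2 + f₁ p ^ 2)) ∂boxMeasure Q P) *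
      ∫ p, (f p ^ 2 + f₀ p ^ 2) ∂boxMeasure Q P with hM
  have hM0 : 0 ≤ M := mul_nonneg (mul_nonneg (by positivity)
    (integral_nonneg fun p => by positivity)) (integral_nonneg fun p => by positivity)
  have hT : (∫ p, (f p * g p) ^ 2 ∂boxMeasure Q P) ^ 2 ≤ (∫ p, g p ^ 2 ∂boxMeasure Q P) *
      (M * (2 * P⁻¹ ^ 2 + 8) *
        ∫ p, (g p ^ 2 + (g₂ p ^ 2 + g₁ p ^ 2)) ∂boxMeasure Q P) := by
    rw [integral_prod _ (integrable_boxMeasure Q P cfg),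
      integral_prod _ (integrable_boxMeasure Q P cg),
      integral_prod _ (integrable_boxMeasure Q P cE), ← integral_const_mul]
    refine sq_integral_le_of_sq_le_mul
      (integrable_segMeasure Q (continuous_integral_squareMeasure P cfg))
      (integrable_segMeasure Q (continuous_integral_squareMeasure P cg))
      (integrable_segMeasure Q ((continuous_integral_squareMeasure P cE).const_mul _))
      (fun z => integral_nonneg fun q => by positivity)
      (fun z => mul_nonneg (by positivity) (integral_nonneg fun q => by positivity)) ?_
    filter_upwards [ae_restrict_mem measurableSet_Icc] with z hz
    have hfz := integral_pow_four_le hP hQ h₀ h₁ h₂ hf hf₀ hf₁ hf₂ hz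
    have hgz := integral_pow_le_integral_pow_mul hP 1 (u := fun q => g (z, q))
      (fun q => k₁ (z, q)) (fun q => k₂ (z, q)) (by fun_prop) (by fun_prop) (by fun_prop)
    norm_num at hgz
    have hz2 : (∫ q, (f (z, q) * g (z, q)) ^ 2 ∂squareMeasure P) ^ 2 ≤
        (∫ q, f (z, q) ^ 4 ∂squareMeasure P) * ∫ q, g (z, q) ^ 4 ∂squareMeasure P :=
      sq_integral_le_of_sq_le_mul (integrable_squareMeasure P (by fun_prop))
        (integrable_squareMeasure P (by fun_prop)) (integrable_squareMeasure P (by fun_prop))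
        (fun q => by positivity) (fun q => by positivity)
        (ae_of_all _ fun q => le_of_eq (by ring))
    refine hz2.trans ((mul_le_mul hfz hgz (integral_nonneg fun q => by positivity)
      hM0).trans (le_of_eq ?_))
    ring
  have hh0 : 0 ≤ ∫ p, h p ^ 2 ∂boxMeasure Q P := integral_nonneg fun p => by positivity
  calc (∫ p, |f p * g p * h p| ∂boxMeasure Q P) ^ 4
      = ((∫ p, |f p * g p * h p| ∂boxMeasure Q P) ^ 2) ^ 2 := by ring
    _ ≤ ((∫ p, (f p * g p) ^ 2 ∂boxMeasure Q P) * ∫ p, h p ^ 2 ∂boxMeasure Q P) ^ 2 := by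
        gcongr
    _ = (∫ p, (f p * g p) ^ 2 ∂boxMeasure Q P) ^ 2 * (∫ p, h p ^ 2 ∂boxMeasure Q P) ^ 2 :=
        mul_pow _ _ _
    _ ≤ _ := mul_le_mul_of_nonneg_right hT (sq_nonneg _)
    _ = _ := by rw [hM]; ring

lemma intOmega_eq_integral {L : ℝ} (hL : 0 < L) {F : ℝ → ℝ → ℝ → ℝ}
    (hF : Continuous fun p : ℝ × ℝ × ℝ => F p.2.2 p.2.1 p.1) :
    intOmega L F = ∫ p, F p.2.2 p.2.1 p.1 ∂boxMeasure (2 * π) (2 * π * L) := by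
  have hP : 0 ≤ 2 * π * L := by positivity
  have hQ : 0 ≤ 2 * π := by positivity
  rw [integral_prod _ (integrable_boxMeasure _ _ hF)]
  simp only [intOmega, intervalIntegral.integral_of_le hP, intervalIntegral.integral_of_le hQ,
    ← integral_Icc_eq_integral_Ioc]
  congr 1 with z
  exact (integral_prod _ (integrable_squareMeasure _ (hF.comp (Continuous.prodMk_right z)))).symm

/-- The function `f` in the coordinates `(z, y, x)`. -/
def zyx (f : ℝ → ℝ → ℝ → ℝ) (p : ℝ × ℝ × ℝ) : ℝ := f p.2.2 p.2.1 p.1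

section Smooth3
variable {f : ℝ → ℝ → ℝ → ℝ}

lemma Smooth3.contDiff_zyx (hf : Smooth3 f) : ContDiff ℝ (⊤ : ℕ∞) (zyx f) :=
  ContDiff.comp (g := fun p : ℝ × ℝ × ℝ => f p.1 p.2.1 p.2.2)
    (f := fun p : ℝ × ℝ × ℝ => (p.2.2, p.2.1, p.1)) hf (by fun_prop)

lemma Smooth3.hasFDerivAt_zyx (hf : Smooth3 f) (p : ℝ × ℝ × ℝ) :
    HasFDerivAt (zyx f) (fderiv ℝ (zyx f) p) p :=
  (hf.contDiff_zyx.differentiable (by simp) p).hasFDerivAt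

lemma Smooth3.continuous_fderiv_zyx (hf : Smooth3 f) (v : ℝ × ℝ × ℝ) :
    Continuous fun p => fderiv ℝ (zyx f) p v :=
  (hf.contDiff_zyx.continuous_fderiv (by simp)).clm_apply continuous_const

lemma Smooth3.hasDerivAt_fst (hf : Smooth3 f) (p : ℝ × ℝ × ℝ) :
    HasDerivAt (fun s => zyx f (s, p.2)) (fderiv ℝ (zyx f) p (1, 0, 0)) p.1 :=
  HasFDerivAt.comp_hasDerivAt (f := fun s => (s, p.2)) p.1 (hf.hasFDerivAt_zyx p)
    ((hasDerivAt_id p.1).prodMk (hasDerivAt_const p.1 p.2))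

lemma Smooth3.hasDerivAt_snd_fst (hf : Smooth3 f) (p : ℝ × ℝ × ℝ) :
    HasDerivAt (fun s => zyx f (p.1, s, p.2.2)) (fderiv ℝ (zyx f) p (0, 1, 0)) p.2.1 :=
  HasFDerivAt.comp_hasDerivAt (f := fun s => (p.1, s, p.2.2)) p.2.1 (hf.hasFDerivAt_zyx p)
    ((hasDerivAt_const p.2.1 p.1).prodMk
      ((hasDerivAt_id p.2.1).prodMk (hasDerivAt_const p.2.1 p.2.2)))

lemma Smooth3.hasDerivAt_snd_snd (hf : Smooth3 f) (p : ℝ × ℝ × ℝ) :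
    HasDerivAt (fun s => zyx f (p.1, p.2.1, s)) (fderiv ℝ (zyx f) p (0, 0, 1)) p.2.2 :=
  HasFDerivAt.comp_hasDerivAt (f := fun s => (p.1, p.2.1, s)) p.2.2 (hf.hasFDerivAt_zyx p)
    ((hasDerivAt_const p.2.2 p.1).prodMk
      ((hasDerivAt_const p.2.2 p.2.1).prodMk (hasDerivAt_id p.2.2)))

lemma Smooth3.zyx_pdz (hf : Smooth3 f) :
    zyx (pdz f) = fun p => fderiv ℝ (zyx f) p (1, 0, 0) :=
  funext fun p => (hf.hasDerivAt_fst p).deriv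

lemma Smooth3.zyx_pdy (hf : Smooth3 f) :
    zyx (pdy f) = fun p => fderiv ℝ (zyx f) p (0, 1, 0) :=
  funext fun p => (hf.hasDerivAt_snd_fst p).deriv

lemma Smooth3.zyx_pdx (hf : Smooth3 f) :
    zyx (pdx f) = fun p => fderiv ℝ (zyx f) p (0, 0, 1) :=
  funext fun p => (hf.hasDerivAt_snd_snd p).deriv

variable {L : ℝ}

lemma Smooth3.l2norm_sq (hL : 0 < L) (hf : Smooth3 f) :
    l2norm L f ^ 2 = ∫ p, zyx f p ^ 2 ∂boxMeasure (2 * π) (2 * π * L) := by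
  have hc := hf.contDiff_zyx.continuous
  rw [l2norm, intOmega_eq_integral hL (hc.pow 2)]
  exact Real.sq_sqrt (integral_nonneg fun p => by positivity)

lemma Smooth3.pdznorm_sq (hL : 0 < L) (hf : Smooth3 f) :
    pdznorm L f ^ 2 = ∫ p, zyx (pdz f) p ^ 2 ∂boxMeasure (2 * π) (2 * π * L) := by
  have hc : Continuous (zyx (pdz f)) := hf.zyx_pdz ▸ hf.continuous_fderiv_zyx _
  rw [pdznorm, intOmega_eq_integral hL (hc.pow 2)]
  exact Real.sq_sqrt (integral_nonneg fun p => by positivity)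

lemma Smooth3.gradHnorm_sq (hL : 0 < L) (hf : Smooth3 f) :
    gradHnorm L f ^ 2 =
      ∫ p, (zyx (pdx f) p ^ 2 + zyx (pdy f) p ^ 2) ∂boxMeasure (2 * π) (2 * π * L) := by
  have hx : Continuous (zyx (pdx f)) := hf.zyx_pdx ▸ hf.continuous_fderiv_zyx _
  have hy : Continuous (zyx (pdy f)) := hf.zyx_pdy ▸ hf.continuous_fderiv_zyx _
  rw [gradHnorm, intOmega_eq_integral hL ((hx.pow 2).add (hy.pow 2))]
  exact Real.sq_sqrt (integral_nonneg fun p => by positivity)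

lemma Smooth3.integral_sq_add_gradH_le (hL : 0 < L) (hf : Smooth3 f) :
    ∫ p, (zyx f p ^ 2 + (zyx (pdx f) p ^ 2 + zyx (pdy f) p ^ 2))
      ∂boxMeasure (2 * π) (2 * π * L) ≤ (l2norm L f + gradHnorm L f) ^ 2 := by
  have hc := hf.contDiff_zyx.continuous
  have hx : Continuous (zyx (pdx f)) := hf.zyx_pdx ▸ hf.continuous_fderiv_zyx _
  have hy : Continuous (zyx (pdy f)) := hf.zyx_pdy ▸ hf.continuous_fderiv_zyx _
  rw [integral_add (integrable_boxMeasure _ _ (by fun_prop))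
    (integrable_boxMeasure _ _ (by fun_prop)), ← hf.l2norm_sq hL, ← hf.gradHnorm_sq hL]
  have h₁ : 0 ≤ l2norm L f := Real.sqrt_nonneg _
  have h₂ : 0 ≤ gradHnorm L f := Real.sqrt_nonneg _
  nlinarith [mul_nonneg h₁ h₂]

lemma Smooth3.integral_sq_add_pdz_le (hL : 0 < L) (hf : Smooth3 f) :
    ∫ p, (zyx f p ^ 2 + zyx (pdz f) p ^ 2)
      ∂boxMeasure (2 * π) (2 * π * L) ≤ (l2norm L f + pdznorm L f) ^ 2 := by
  have hc := hf.contDiff_zyx.continuous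
  have hz : Continuous (zyx (pdz f)) := hf.zyx_pdz ▸ hf.continuous_fderiv_zyx _
  rw [integral_add (integrable_boxMeasure _ _ (by fun_prop))
    (integrable_boxMeasure _ _ (by fun_prop)), ← hf.l2norm_sq hL, ← hf.pdznorm_sq hL]
  have h₁ : 0 ≤ l2norm L f := Real.sqrt_nonneg _
  have h₂ : 0 ≤ pdznorm L f := Real.sqrt_nonneg _
  nlinarith [mul_nonneg h₁ h₂]

end Smooth3

/-- Anisotropic Ladyzhenskaya-type inequality. -/
theorem anisotropic_ladyzhenskaya (L : ℝ) (hL : 0 < L) :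
    ∃ C : ℝ, 0 < C ∧ ∀ f g h : ℝ → ℝ → ℝ → ℝ,
      Smooth3 f → OmegaPeriodic L f →
      Smooth3 g → OmegaPeriodic L g →
      Smooth3 h → OmegaPeriodic L h →
      intOmega L (fun x y z => |f x y z * g x y z * h x y z|) ≤
        C * Real.sqrt (l2norm L f + gradHnorm L f)
          * Real.sqrt (l2norm L f + pdznorm L f)
          * Real.sqrt (l2norm L g)
          * Real.sqrt (l2norm L g + gradHnorm L g)
          * l2norm L h := by
  set K : ℝ := (2 * (2 * π * L)⁻¹ ^ 2 + 18) * (2 * (2 * π)⁻¹ ^ 2 + 32) *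
    (2 * (2 * π * L)⁻¹ ^ 2 + 8) with hK
  have hK1 : 1 ≤ K + 1 := by
    have : 0 ≤ K := by positivity
    linarith
  refine ⟨K + 1, by linarith, fun f g h hf _ hg _ hh _ => ?_⟩
  have cf := hf.contDiff_zyx.continuous
  have cg := hg.contDiff_zyx.continuous
  have ch := hh.contDiff_zyx.continuous
  have main := pow_four_integral_abs_mul_le (P := 2 * π * L) (Q := 2 * π) (by positivity)
    (by positivity) hf.hasDerivAt_fst hf.hasDerivAt_snd_fst hf.hasDerivAt_snd_snd cf
    (hf.continuous_fderiv_zyx _) (hf.continuous_fderiv_zyx _) (hf.continuous_fderiv_zyx _)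
    hg.hasDerivAt_snd_fst hg.hasDerivAt_snd_snd cg
    (hg.continuous_fderiv_zyx _) (hg.continuous_fderiv_zyx _) ch
  have eF : ∀ u, Smooth3 u → ∀ p, fderiv ℝ (zyx u) p (1, 0, 0) = zyx (pdz u) p ∧
      fderiv ℝ (zyx u) p (0, 1, 0) = zyx (pdy u) p ∧
      fderiv ℝ (zyx u) p (0, 0, 1) = zyx (pdx u) p := fun u hu p => by
    rw [hu.zyx_pdx, hu.zyx_pdy, hu.zyx_pdz]; exact ⟨rfl, rfl, rfl⟩
  simp only [eF f hf, eF g hg] at main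
  rw [← hg.l2norm_sq hL, ← hh.l2norm_sq hL, ← hK] at main
  have hHf := hf.integral_sq_add_gradH_le hL
  have hVf := hf.integral_sq_add_pdz_le hL
  have hHg := hg.integral_sq_add_gradH_le hL
  rw [intOmega_eq_integral hL ((cf.mul cg).mul ch).abs]
  have n1 : 0 ≤ l2norm L f + gradHnorm L f := add_nonneg (sqrt_nonneg _) (sqrt_nonneg _)
  have n2 : 0 ≤ l2norm L f + pdznorm L f := add_nonneg (sqrt_nonneg _) (sqrt_nonneg _)
  have n3 : 0 ≤ l2norm L g := sqrt_nonneg _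
  have n4 : 0 ≤ l2norm L g + gradHnorm L g := add_nonneg (sqrt_nonneg _) (sqrt_nonneg _)
  have n5 : 0 ≤ l2norm L h := sqrt_nonneg _
  refine le_of_pow_le_pow_left₀ (n := 4) (by norm_num) (by positivity) (main.trans ?_)
  have q : ∀ a : ℝ, 0 ≤ a → √a ^ 4 = a ^ 2 := fun a ha => by
    rw [show √a ^ 4 = (√a ^ 2) ^ 2 by ring, sq_sqrt ha]
  simp only [mul_pow, q _ n1, q _ n2, q _ n3, q _ n4]
  have hKK : K ≤ (K + 1) ^ 4 :=
    (by linarith : K ≤ K + 1).trans (le_self_pow₀ hK1 (by norm_num))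
  rw [show (l2norm L h ^ 2) ^ 2 = l2norm L h ^ 4 by ring]
  have m1 : 0 ≤ ∫ p, (zyx f p ^ 2 + zyx (pdz f) p ^ 2) ∂boxMeasure (2 * π) (2 * π * L) :=
    integral_nonneg fun p => by positivity
  have m2 : 0 ≤ ∫ p, (zyx f p ^ 2 + (zyx (pdx f) p ^ 2 + zyx (pdy f) p ^ 2))
      ∂boxMeasure (2 * π) (2 * π * L) := integral_nonneg fun p => by positivity
  have m3 : 0 ≤ ∫ p, (zyx g p ^ 2 + (zyx (pdx g) p ^ 2 + zyx (pdy g) p ^ 2))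
      ∂boxMeasure (2 * π) (2 * π * L) := integral_nonneg fun p => by positivity
  gcongr
end
end

section
/- Let L > 0 and Ra ∈ ℝ. Let a : ℤ³ → ℂ satisfy a(k) = 0 whenever k₁² + k₂² = 0 and Σ_{k∈ℤ³} |a(k)|² < ∞, and for k with k₁² + k₂² ≠ 0 define û(k) = Ra · (−(k₂/L) k₃ / (k₃² + κ_k³)) · a(k) and v̂(k) = Ra · ((k₁/L) k₃ / (k₃² + κ_k³)) · a(k), and û(k) = v̂(k) = 0 otherwise. Then Σ_{k∈ℤ³} κ_k² ( |û(k)|² + |v̂(k)|² ) ≤ Ra² Σ_{k∈ℤ³} |a(k)|². -/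
noncomputable section
open Real

/-- For `k = (k₁,k₂,k₃) ∈ ℤ³`, `κ_k = (k₁² + k₂²)/L²`. -/
def kappa (L : ℝ) (k : ℤ × ℤ × ℤ) : ℝ := ((k.1^2 + k.2.1^2 : ℤ) : ℝ) / L^2

lemma kappa_nonneg (L : ℝ) (k : ℤ × ℤ × ℤ) : 0 ≤ kappa L k := by
  unfold kappa
  positivity

lemma horizontal_symbol_le_one {x y m κ : ℝ} (hκ : κ = x ^ 2 + y ^ 2) (hpos : 0 < κ) :
    κ ^ 2 * ((-y * m / (m ^ 2 + κ ^ 3)) ^ 2 + (x * m / (m ^ 2 + κ ^ 3)) ^ 2) ≤ 1 := by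
  have hD : 0 < m ^ 2 + κ ^ 3 := by positivity
  have hsum : κ ^ 2 * ((-y * m / (m ^ 2 + κ ^ 3)) ^ 2 + (x * m / (m ^ 2 + κ ^ 3)) ^ 2)
      = κ ^ 3 * m ^ 2 / (m ^ 2 + κ ^ 3) ^ 2 := by
    rw [div_pow, div_pow, ← add_div, mul_div_assoc']
    congr 1
    linear_combination (-(κ ^ 2 * m ^ 2)) * hκ
  rw [hsum, div_le_one (by positivity)]
  have h3 : 0 < κ ^ 3 := by positivity
  nlinarith [sq_nonneg (m ^ 2), sq_nonneg (κ ^ 3), mul_nonneg h3.le (sq_nonneg m)]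

/-- Fourier-coefficient form of the estimate `‖Δ_h u‖₂² ≤ Ra² ‖θ'‖₂²` for the horizontal
velocity `(u,v)`. -/
theorem deltaH_u_estimate (L Ra : ℝ) (hL : 0 < L)
    (a u v : ℤ × ℤ × ℤ → ℂ)
    (ha0 : ∀ k : ℤ × ℤ × ℤ, k.1^2 + k.2.1^2 = 0 → a k = 0)
    (ha : Summable fun k : ℤ × ℤ × ℤ => ‖a k‖^2)
    (hu : ∀ k : ℤ × ℤ × ℤ, u k =
      if k.1^2 + k.2.1^2 ≠ 0 then
        ((Ra * (-((k.2.1:ℝ)/L) * (k.2.2:ℝ) / (((k.2.2:ℝ))^2 + kappa L k ^ 3)) : ℝ) : ℂ) * a k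
      else 0)
    (hv : ∀ k : ℤ × ℤ × ℤ, v k =
      if k.1^2 + k.2.1^2 ≠ 0 then
        ((Ra * (((k.1:ℝ)/L) * (k.2.2:ℝ) / (((k.2.2:ℝ))^2 + kappa L k ^ 3)) : ℝ) : ℂ) * a k
      else 0) :
    ∑' k : ℤ × ℤ × ℤ, kappa L k ^ 2 * (‖u k‖^2 + ‖v k‖^2)
      ≤ Ra^2 * ∑' k : ℤ × ℤ × ℤ, ‖a k‖^2 := by
  have hpt : ∀ k, kappa L k ^ 2 * (‖u k‖ ^ 2 + ‖v k‖ ^ 2) ≤ Ra ^ 2 * ‖a k‖ ^ 2 := by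
    intro k
    rw [hu k, hv k]
    by_cases hk : k.1 ^ 2 + k.2.1 ^ 2 = 0
    · simp [hk, ha0 k hk]
    rw [if_pos hk, if_pos hk]
    have hκ : kappa L k = ((k.1 : ℝ) / L) ^ 2 + ((k.2.1 : ℝ) / L) ^ 2 := by
      unfold kappa
      push_cast
      ring
    have hκ0 : kappa L k ≠ 0 :=
      div_ne_zero (Int.cast_ne_zero.mpr hk) (pow_ne_zero 2 hL.ne')
    have h := horizontal_symbol_le_one (m := (k.2.2 : ℝ)) hκ
      ((kappa_nonneg L k).lt_of_ne' hκ0)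
    simp only [norm_mul, Complex.norm_real, Real.norm_eq_abs, mul_pow, sq_abs]
    have := mul_le_mul_of_nonneg_left h (by positivity : 0 ≤ Ra ^ 2 * ‖a k‖ ^ 2)
    linarith
  have hs := ha.mul_left (Ra ^ 2)
  rw [← tsum_mul_left]
  exact (hs.of_nonneg_of_le (fun k => by positivity) hpt).tsum_le_tsum hpt hs
end
end

section
/- Let L > 0 and Ra ∈ ℝ. Let a : ℤ³ → ℂ satisfy a(k) = 0 whenever k₁² + k₂² = 0 and Σ_{k∈ℤ³} κ_k |a(k)|² < ∞, and for k with k₁² + k₂² ≠ 0 define û(k) = Ra · (−(k₂/L) k₃ / (k₃² + κ_k³)) · a(k), v̂(k) = Ra · ((k₁/L) k₃ / (k₃² + κ_k³)) · a(k), and ŵ(k) = Ra · (κ_k² / (k₃² + κ_k³)) · a(k), all zero otherwise. Then Σ_{k∈ℤ³} k₃² ( |û(k)|² + |v̂(k)|² ) ≤ Ra² Σ_{k∈ℤ³} κ_k |a(k)|² and Σ_{k∈ℤ³} k₃² |ŵ(k)|² ≤ Ra² Σ_{k∈ℤ³} κ_k |a(k)|². -/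
noncomputable section
open Real

theorem kappa_pos {L : ℝ} (hL : 0 < L) {k : ℤ × ℤ × ℤ} (hk : k.1^2 + k.2.1^2 ≠ 0) :
    0 < kappa L k := by
  have h : 0 < k.1^2 + k.2.1^2 := lt_of_le_of_ne (by positivity) hk.symm
  have h' : (0 : ℝ) < ((k.1^2 + k.2.1^2 : ℤ) : ℝ) := by exact_mod_cast h
  unfold kappa
  positivity

theorem kappa_eq_add_sq (L : ℝ) (k : ℤ × ℤ × ℤ) :
    kappa L k = ((k.1 : ℝ) / L)^2 + ((k.2.1 : ℝ) / L)^2 := by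
  unfold kappa
  push_cast
  ring

theorem norm_ofReal_mul_sq (r : ℝ) (z : ℂ) : ‖(r : ℂ) * z‖^2 = r^2 * ‖z‖^2 := by
  rw [norm_mul, mul_pow, Complex.norm_real, Real.norm_eq_abs, sq_abs]

theorem tsum_le_mul_tsum_of_nonneg_of_le {ι : Type*} {f g : ι → ℝ} {c : ℝ}
    (hf : ∀ i, 0 ≤ f i) (hfg : ∀ i, f i ≤ c * g i) (hg : Summable g) :
    ∑' i, f i ≤ c * ∑' i, g i := by
  have hcg : Summable fun i => c * g i := hg.mul_left c
  rw [← tsum_mul_left]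
  exact (Summable.of_nonneg_of_le hf hfg hcg).tsum_le_tsum hfg hcg

theorem sq_mul_horizontal_symbol_le {p q m κ : ℝ} (hκ : 0 < κ) (h : κ = p^2 + q^2) :
    m^2 * ((-q * m / (m^2 + κ^3))^2 + (p * m / (m^2 + κ^3))^2) ≤ κ := by
  have hD : 0 < m^2 + κ^3 := by positivity
  have key : m^2 * ((-q * m / (m^2 + κ^3))^2 + (p * m / (m^2 + κ^3))^2)
      = κ * (m^2 / (m^2 + κ^3))^2 := by
    have e : ∀ D : ℝ, m^2 * ((-q * m / D)^2 + (p * m / D)^2)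
        = (p^2 + q^2) * (m^2 / D)^2 := fun D => by ring
    rw [e, ← h]
  have h1 : m^2 / (m^2 + κ^3) ≤ 1 := by
    rw [div_le_one hD]
    linarith [pow_pos hκ 3]
  rw [key]
  exact mul_le_of_le_one_right hκ.le (pow_le_one₀ (by positivity) h1)

theorem sq_mul_vertical_symbol_le {m κ : ℝ} (hκ : 0 < κ) :
    m^2 * (κ^2 / (m^2 + κ^3))^2 ≤ κ := by
  have hc : 0 < κ^3 := pow_pos hκ 3
  have hD : 0 < m^2 + κ^3 := by positivity
  rw [div_pow, ← mul_div_assoc, div_le_iff₀ (by positivity)]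
  have h : m^2 * κ^3 ≤ (m^2 + κ^3)^2 := by
    nlinarith [sq_nonneg m, sq_nonneg (m^2), mul_nonneg (sq_nonneg m) hc.le]
  calc m^2 * (κ^2)^2 = κ * (m^2 * κ^3) := by ring
    _ ≤ κ * (m^2 + κ^3)^2 := mul_le_mul_of_nonneg_left h hκ.le

/-- Fourier-coefficient form of the estimates `‖∂_z u‖₂² ≤ Ra² ‖∇_h θ'‖₂²` and
`‖∂_z w‖₂² ≤ Ra² ‖∇_h θ'‖₂²`. -/
theorem dz_velocity_estimate (L Ra : ℝ) (hL : 0 < L)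
    (a u v w : ℤ × ℤ × ℤ → ℂ)
    (ha0 : ∀ k : ℤ × ℤ × ℤ, k.1^2 + k.2.1^2 = 0 → a k = 0)
    (ha : Summable fun k : ℤ × ℤ × ℤ => kappa L k * ‖a k‖^2)
    (hu : ∀ k : ℤ × ℤ × ℤ, u k =
      if k.1^2 + k.2.1^2 ≠ 0 then
        ((Ra * (-((k.2.1:ℝ)/L) * (k.2.2:ℝ) / (((k.2.2:ℝ))^2 + kappa L k ^ 3)) : ℝ) : ℂ) * a k
      else 0)
    (hv : ∀ k : ℤ × ℤ × ℤ, v k =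
      if k.1^2 + k.2.1^2 ≠ 0 then
        ((Ra * (((k.1:ℝ)/L) * (k.2.2:ℝ) / (((k.2.2:ℝ))^2 + kappa L k ^ 3)) : ℝ) : ℂ) * a k
      else 0)
    (hw : ∀ k : ℤ × ℤ × ℤ, w k =
      if k.1^2 + k.2.1^2 ≠ 0 then
        ((Ra * (kappa L k ^ 2 / (((k.2.2:ℝ))^2 + kappa L k ^ 3)) : ℝ) : ℂ) * a k
      else 0) :
    (∑' k : ℤ × ℤ × ℤ, ((k.2.2:ℝ))^2 * (‖u k‖^2 + ‖v k‖^2)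
        ≤ Ra^2 * ∑' k : ℤ × ℤ × ℤ, kappa L k * ‖a k‖^2) ∧
    (∑' k : ℤ × ℤ × ℤ, ((k.2.2:ℝ))^2 * ‖w k‖^2
        ≤ Ra^2 * ∑' k : ℤ × ℤ × ℤ, kappa L k * ‖a k‖^2) := by
  constructor
  · refine tsum_le_mul_tsum_of_nonneg_of_le (fun k => by positivity) (fun k => ?_) ha
    by_cases hk : k.1^2 + k.2.1^2 = 0
    · simp [hu, hv, hk, ha0 k hk]
    · rw [hu, hv, if_pos hk, if_pos hk, norm_ofReal_mul_sq, norm_ofReal_mul_sq]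
      have h := mul_le_mul_of_nonneg_left
        (sq_mul_horizontal_symbol_le (m := (k.2.2 : ℝ)) (kappa_pos hL hk) (kappa_eq_add_sq L k))
        (by positivity : 0 ≤ Ra^2 * ‖a k‖^2)
      rw [mul_pow Ra, mul_pow Ra]
      linarith
  · refine tsum_le_mul_tsum_of_nonneg_of_le (fun k => by positivity) (fun k => ?_) ha
    by_cases hk : k.1^2 + k.2.1^2 = 0
    · simp [hw, hk, ha0 k hk]
    · rw [hw, if_pos hk, norm_ofReal_mul_sq]
      have h := mul_le_mul_of_nonneg_left
        (sq_mul_vertical_symbol_le (m := (k.2.2 : ℝ)) (kappa_pos hL hk))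
        (by positivity : 0 ≤ Ra^2 * ‖a k‖^2)
      rw [mul_pow Ra]
      linarith
end
end

section
/- There exists a constant C > 0, depending only on L, such that for all smooth Ω-periodic functions f, g : ℝ³ → ℝ one has ∫₀^{2π} | (d/dz) \overline{f g}(z) |² dz ≤ C [ ( ‖g‖₂² + ‖∂_z g‖₂² ) ‖∂_z f‖₂² + ( ‖f‖₂² + ‖∂_z f‖₂² ) ‖∂_z g‖₂² ], where \overline{f g}(z) = (1/(4π²L²)) ∫_{[0,2πL]²} f(x,y,z) g(x,y,z) dx dy. -/
noncomputable section
open Real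

/-- Squared `L²(Ω)` norm. -/
def l2sq (L : ℝ) (f : ℝ → ℝ → ℝ → ℝ) : ℝ := intOmega L (fun x y z => (f x y z)^2)

/-- The horizontal mean of `f` at height `z`. -/
def hmean (L : ℝ) (f : ℝ → ℝ → ℝ → ℝ) (z : ℝ) : ℝ :=
  (1/(4*π^2*L^2)) * ∫ y in (0:ℝ)..(2*π*L), ∫ x in (0:ℝ)..(2*π*L), f x y z

section Slices

open MeasureTheory Set

/-- The integral of a continuous function over slices of a compact set is differentiable in the
parameter, with the derivative taken under the integral sign. -/
theorem hasDerivAt_setIntegral_of_continuous {K : Set (ℝ × ℝ)} (hK : IsCompact K)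
    {u u' : ℝ → ℝ × ℝ → ℝ} (hu : Continuous u.uncurry) (hu' : Continuous u'.uncurry)
    (hd : ∀ z p, HasDerivAt (fun s => u s p) (u' z p) z) (z : ℝ) :
    HasDerivAt (fun s => ∫ p in K, u s p) (∫ p in K, u' z p) z := by
  have hslice : ∀ {v : ℝ → ℝ × ℝ → ℝ}, Continuous v.uncurry → ∀ s, Continuous (v s) :=
    fun hv s => hv.comp (by fun_prop : Continuous fun p : ℝ × ℝ => (s, p))
  obtain ⟨M, hM⟩ := ((isCompact_closedBall z 1).prod hK).exists_bound_of_continuousOn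
    hu'.continuousOn
  refine (hasDerivAt_integral_of_dominated_loc_of_deriv_le (bound := fun _ => M)
    (Metric.ball_mem_nhds z one_pos)
    (Filter.Eventually.of_forall fun s => (hslice hu s).aestronglyMeasurable)
    ((hslice hu z).continuousOn.integrableOn_compact hK)
    (hslice hu' z).aestronglyMeasurable ?_ ?_ ?_).2
  · filter_upwards [ae_restrict_mem hK.measurableSet] with p hp s hs
    exact hM (s, p) ⟨Metric.ball_subset_closedBall hs, hp⟩
  · exact integrableOn_const hK.measure_lt_top.ne
  · exact Filter.Eventually.of_forall fun p s _ => hd s p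

/-- Cauchy–Schwarz for continuous functions on a compact set. -/
theorem sq_setIntegral_mul_le {K : Set (ℝ × ℝ)} (hK : IsCompact K) {u v : ℝ × ℝ → ℝ}
    (hu : Continuous u) (hv : Continuous v) :
    (∫ p in K, u p * v p) ^ 2 ≤ (∫ p in K, u p ^ 2) * ∫ p in K, v p ^ 2 := by
  have hi : ∀ {w : ℝ × ℝ → ℝ}, Continuous w → IntegrableOn w K :=
    fun hw => hw.continuousOn.integrableOn_compact hK
  have key : ∀ t : ℝ, 0 ≤ (∫ p in K, u p ^ 2) * (t * t) + (2 * ∫ p in K, u p * v p) * t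
      + ∫ p in K, v p ^ 2 := by
    intro t
    have h0 : 0 ≤ ∫ p in K, (t * u p + v p) ^ 2 := integral_nonneg fun p => sq_nonneg _
    have h1 : ∫ p in K, (t * u p + v p) ^ 2
        = ∫ p in K, ((t * t) * u p ^ 2 + (2 * t) * (u p * v p)) + v p ^ 2 := by
      congr 1; ext p; ring
    rw [h1, integral_add (hi (by fun_prop)) (hi (by fun_prop)),
      integral_add (hi (by fun_prop)) (hi (by fun_prop)), integral_const_mul,
      integral_const_mul] at h0
    linarith
  have := discrim_le_zero key
  simp only [discrim] at this
  nlinarith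

/-- One-dimensional Sobolev bound: a nonnegative differentiable function whose derivative is
dominated by a function `D` is bounded by its mean plus the integral of `D`. -/
theorem mul_le_integral_add_of_abs_deriv_le {T : ℝ} (hT : 0 ≤ T) {A A' D : ℝ → ℝ}
    (hA' : Continuous A') (hD : Continuous D) (hd : ∀ z, HasDerivAt A (A' z) z)
    (hb : ∀ z, |A' z| ≤ D z) {z : ℝ} (hz : z ∈ Icc 0 T) :
    T * A z ≤ (∫ s in (0:ℝ)..T, A s) + T * ∫ s in (0:ℝ)..T, D s := by
  have hAc : Continuous A := continuous_iff_continuousAt.2 fun z => (hd z).continuousAt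
  have hD0 : ∀ s, 0 ≤ D s := fun s => (abs_nonneg _).trans (hb s)
  have hpt : ∀ s ∈ Icc 0 T, A z ≤ A s + ∫ s in (0:ℝ)..T, D s := by
    intro s hs
    have h1 : ∫ r in s..z, A' r = A z - A s :=
      intervalIntegral.integral_eq_sub_of_hasDerivAt (fun r _ => hd r)
        (hA'.intervalIntegrable _ _)
    have h2 : |∫ r in s..z, A' r| ≤ ∫ r in (0:ℝ)..T, D r := by
      rw [← Real.norm_eq_abs, intervalIntegral.integral_of_le hT]
      refine (intervalIntegral.norm_integral_le_integral_norm_uIoc).trans ?_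
      refine (setIntegral_mono (hA'.norm.integrableOn_uIoc) (hD.integrableOn_uIoc) hb).trans ?_
      refine setIntegral_mono_set (hD.integrableOn_Ioc)
        (Filter.Eventually.of_forall hD0) (LE.le.eventuallyLE ?_)
      exact Ioc_subset_Ioc (le_min hs.1 hz.1) (max_le hs.2 hz.2)
    linarith [le_abs_self (∫ r in s..z, A' r)]
  have h := intervalIntegral.integral_mono_on hT
    (continuous_const.intervalIntegrable (μ := volume) 0 T)
    ((hAc.add continuous_const).intervalIntegrable 0 T) hpt
  simp only [Pi.add_apply] at h
  rw [intervalIntegral.integral_add (hAc.intervalIntegrable _ _)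
    (continuous_const.intervalIntegrable _ _)] at h
  simpa using h

/-- Bound for the squared slice norm of a function in terms of its norm and that of its
derivative in the parameter. -/
theorem setIntegral_sq_le_of_hasDerivAt {K : Set (ℝ × ℝ)} (hK : IsCompact K) {T : ℝ}
    (hT : 1 ≤ T) {u u' : ℝ → ℝ × ℝ → ℝ} (hu : Continuous u.uncurry)
    (hu' : Continuous u'.uncurry) (hd : ∀ z p, HasDerivAt (fun s => u s p) (u' z p) z)
    {z : ℝ} (hz : z ∈ Icc 0 T) :
    ∫ p in K, u z p ^ 2 ≤ 2 * ((∫ s in (0:ℝ)..T, ∫ p in K, u s p ^ 2)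
      + ∫ s in (0:ℝ)..T, ∫ p in K, u' s p ^ 2) := by
  have hc : ∀ {v : ℝ → ℝ × ℝ → ℝ}, Continuous v.uncurry → Continuous fun s => ∫ p in K, v s p :=
    fun hv => continuous_parametric_integral_of_continuous hv hK
  have hi : ∀ {v : ℝ → ℝ × ℝ → ℝ}, Continuous v.uncurry → ∀ s, IntegrableOn (v s) K :=
    fun hv s => (hv.comp (by fun_prop : Continuous fun p : ℝ × ℝ => (s, p))
      ).continuousOn.integrableOn_compact hK
  have hsq : Continuous (fun s p => u s p ^ 2 : ℝ → ℝ × ℝ → ℝ).uncurry := hu.pow 2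
  have hsq' : Continuous (fun s p => u' s p ^ 2 : ℝ → ℝ × ℝ → ℝ).uncurry := hu'.pow 2
  have hmul : Continuous (fun s p => 2 * u s p * u' s p : ℝ → ℝ × ℝ → ℝ).uncurry :=
    (continuous_const.mul hu).mul hu'
  have h := mul_le_integral_add_of_abs_deriv_le (zero_le_one.trans hT)
    (A := fun s => ∫ p in K, u s p ^ 2) (A' := fun s => ∫ p in K, 2 * u s p * u' s p)
    (D := fun s => (∫ p in K, u s p ^ 2) + ∫ p in K, u' s p ^ 2)
    (hc hmul) ((hc hsq).add (hc hsq'))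
    (hasDerivAt_setIntegral_of_continuous hK hsq hmul fun z p => by
      simpa using (hd z p).fun_pow 2)
    (fun s => by
      rw [← integral_add (hi hsq s) (hi hsq' s), ← Real.norm_eq_abs]
      refine norm_integral_le_of_norm_le ((hi hsq s).add (hi hsq' s))
        (Filter.Eventually.of_forall fun p => ?_)
      rw [Real.norm_eq_abs, abs_le]
      constructor <;>
        nlinarith [sq_nonneg (u s p + u' s p), sq_nonneg (u s p - u' s p)])
    hz
  rw [intervalIntegral.integral_add ((hc hsq).intervalIntegrable _ _)
    ((hc hsq').intervalIntegrable _ _)] at h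
  have h1 : 0 ≤ ∫ s in (0:ℝ)..T, ∫ p in K, u s p ^ 2 :=
    intervalIntegral.integral_nonneg (zero_le_one.trans hT)
      fun s _ => integral_nonneg fun p => sq_nonneg _
  have h2 : 0 ≤ ∫ s in (0:ℝ)..T, ∫ p in K, u' s p ^ 2 :=
    intervalIntegral.integral_nonneg (zero_le_one.trans hT)
      fun s _ => integral_nonneg fun p => sq_nonneg _
  have hT0 : 0 < T := zero_lt_one.trans_le hT
  refine le_of_mul_le_mul_left (h.trans ?_) hT0
  nlinarith

/-- The integral of the squared derivative of the slice pairing of two functions. -/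
theorem integral_sq_deriv_setIntegral_mul_le {K : Set (ℝ × ℝ)} (hK : IsCompact K) {T : ℝ}
    (hT : 1 ≤ T) {u u' v v' : ℝ → ℝ × ℝ → ℝ} (hu : Continuous u.uncurry)
    (hu' : Continuous u'.uncurry) (hv : Continuous v.uncurry) (hv' : Continuous v'.uncurry)
    (hdu : ∀ z p, HasDerivAt (fun s => u s p) (u' z p) z)
    (hdv : ∀ z p, HasDerivAt (fun s => v s p) (v' z p) z) :
    ∫ z in (0:ℝ)..T, (deriv (fun s => ∫ p in K, u s p * v s p) z) ^ 2
      ≤ 4 * (((∫ z in (0:ℝ)..T, ∫ p in K, v z p ^ 2) + ∫ z in (0:ℝ)..T, ∫ p in K, v' z p ^ 2)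
            * (∫ z in (0:ℝ)..T, ∫ p in K, u' z p ^ 2)
          + ((∫ z in (0:ℝ)..T, ∫ p in K, u z p ^ 2) + ∫ z in (0:ℝ)..T, ∫ p in K, u' z p ^ 2)
            * ∫ z in (0:ℝ)..T, ∫ p in K, v' z p ^ 2) := by
  have hs : ∀ {w : ℝ → ℝ × ℝ → ℝ}, Continuous w.uncurry → ∀ s, Continuous (w s) :=
    fun hw s => hw.comp (by fun_prop : Continuous fun p : ℝ × ℝ => (s, p))
  have hc : ∀ {w : ℝ → ℝ × ℝ → ℝ}, Continuous w.uncurry → Continuous fun s => ∫ p in K, w s p :=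
    fun hw => continuous_parametric_integral_of_continuous hw hK
  have hsqu : Continuous (fun s p => u' s p ^ 2 : ℝ → ℝ × ℝ → ℝ).uncurry := hu'.pow 2
  have hsqv : Continuous (fun s p => v' s p ^ 2 : ℝ → ℝ × ℝ → ℝ).uncurry := hv'.pow 2
  have hmul : Continuous (fun s p => u s p * v s p : ℝ → ℝ × ℝ → ℝ).uncurry := hu.mul hv
  have hmul' : Continuous
      (fun s p => u' s p * v s p + u s p * v' s p : ℝ → ℝ × ℝ → ℝ).uncurry :=
    (hu'.mul hv).add (hu.mul hv')
  have hderiv : deriv (fun s => ∫ p in K, u s p * v s p)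
      = fun z => ∫ p in K, (u' z p * v z p + u z p * v' z p) :=
    funext fun z => (hasDerivAt_setIntegral_of_continuous hK hmul hmul'
      (fun z p => (hdu z p).mul (hdv z p)) z).deriv
  rw [hderiv]
  set U := (∫ z in (0:ℝ)..T, ∫ p in K, u z p ^ 2) + ∫ z in (0:ℝ)..T, ∫ p in K, u' z p ^ 2
  set V := (∫ z in (0:ℝ)..T, ∫ p in K, v z p ^ 2) + ∫ z in (0:ℝ)..T, ∫ p in K, v' z p ^ 2
  have hpt : ∀ z ∈ Icc 0 T, (∫ p in K, (u' z p * v z p + u z p * v' z p)) ^ 2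
      ≤ 4 * V * (∫ p in K, u' z p ^ 2) + 4 * U * ∫ p in K, v' z p ^ 2 := by
    intro z hz
    rw [integral_add (f := fun p => u' z p * v z p) (g := fun p => u z p * v' z p)
      (((hs hu' z).mul (hs hv z)).continuousOn.integrableOn_compact hK)
      (((hs hu z).mul (hs hv' z)).continuousOn.integrableOn_compact hK)]
    have h1 := sq_setIntegral_mul_le hK (hs hu' z) (hs hv z)
    have h2 := sq_setIntegral_mul_le hK (hs hu z) (hs hv' z)
    have h3 := mul_le_mul_of_nonneg_left (setIntegral_sq_le_of_hasDerivAt hK hT hv hv' hdv hz)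
      (integral_nonneg fun p => sq_nonneg (u' z p) : 0 ≤ ∫ p in K, u' z p ^ 2)
    have h4 := mul_le_mul_of_nonneg_right (setIntegral_sq_le_of_hasDerivAt hK hT hu hu' hdu hz)
      (integral_nonneg fun p => sq_nonneg (v' z p) : 0 ≤ ∫ p in K, v' z p ^ 2)
    linarith [add_sq_le (a := ∫ p in K, u' z p * v z p) (b := ∫ p in K, u z p * v' z p)]
  have h := intervalIntegral.integral_mono_on (zero_le_one.trans hT)
    (((hc hmul').pow 2).intervalIntegrable (μ := volume) 0 T)
    ((((hc hsqu).intervalIntegrable 0 T).const_mul (4 * V)).add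
      (((hc hsqv).intervalIntegrable 0 T).const_mul (4 * U))) hpt
  rw [intervalIntegral.integral_add
    (((hc hsqu).intervalIntegrable _ _).const_mul _)
    (((hc hsqv).intervalIntegrable _ _).const_mul _),
    intervalIntegral.integral_const_mul, intervalIntegral.integral_const_mul] at h
  refine h.trans (le_of_eq ?_)
  ring

/-- Iterated integrals of a continuous function over a square are integrals over the square. -/
theorem intervalIntegral_intervalIntegral_eq_setIntegral {a : ℝ} (ha : 0 ≤ a) {w : ℝ × ℝ → ℝ}
    (hw : Continuous w) :
    ∫ y in (0:ℝ)..a, ∫ x in (0:ℝ)..a, w (x, y) = ∫ p in Icc 0 a ×ˢ Icc 0 a, w p.swap := by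
  rw [Measure.volume_eq_prod, setIntegral_prod (fun p => w p.swap) ((hw.comp continuous_swap
    ).continuousOn.integrableOn_compact (isCompact_Icc.prod isCompact_Icc)),
    intervalIntegral.integral_of_le ha, integral_Icc_eq_integral_Ioc]
  simp only [intervalIntegral.integral_of_le ha, integral_Icc_eq_integral_Ioc, Prod.swap_prod_mk]

end Slices

theorem Smooth3.hasDerivAt_fderiv {f : ℝ → ℝ → ℝ → ℝ} (hf : Smooth3 f) (x y z : ℝ) :
    HasDerivAt (fun s => f x y s)
      (fderiv ℝ (fun p : ℝ × ℝ × ℝ => f p.1 p.2.1 p.2.2) (x, y, z) (0, 0, 1)) z := by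
  have h : HasDerivAt (fun s : ℝ => (x, y, s)) (0, 0, 1) z :=
    (hasDerivAt_const z x).prodMk ((hasDerivAt_const z y).prodMk (hasDerivAt_id z))
  exact ((hf.differentiable (by simp)) (x, y, z)).hasFDerivAt.comp_hasDerivAt z h

theorem Smooth3.hasDerivAt_pdz {f : ℝ → ℝ → ℝ → ℝ} (hf : Smooth3 f) (x y z : ℝ) :
    HasDerivAt (fun s => f x y s) (pdz f x y z) z :=
  (hf.hasDerivAt_fderiv x y z).differentiableAt.hasDerivAt

theorem Smooth3.continuous_pdz {f : ℝ → ℝ → ℝ → ℝ} (hf : Smooth3 f) :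
    Continuous fun p : ℝ × ℝ × ℝ => pdz f p.1 p.2.1 p.2.2 := by
  have h : (fun p : ℝ × ℝ × ℝ => pdz f p.1 p.2.1 p.2.2)
      = fun p => fderiv ℝ (fun p : ℝ × ℝ × ℝ => f p.1 p.2.1 p.2.2) p (0, 0, 1) :=
    funext fun p => (hf.hasDerivAt_fderiv p.1 p.2.1 p.2.2).deriv
  rw [h]
  exact (hf.continuous_fderiv (by simp)).clm_apply continuous_const

open Set in
theorem l2sq_eq_integral_setIntegral {L : ℝ} (hL : 0 ≤ L) {f : ℝ → ℝ → ℝ → ℝ}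
    (hf : Continuous fun p : ℝ × ℝ × ℝ => f p.1 p.2.1 p.2.2) :
    l2sq L f = ∫ z in (0:ℝ)..(2*π),
      ∫ p in Icc 0 (2*π*L) ×ˢ Icc 0 (2*π*L), (f p.2 p.1 z) ^ 2 := by
  unfold l2sq intOmega
  congr 1
  ext z
  exact intervalIntegral_intervalIntegral_eq_setIntegral (w := fun q => f q.1 q.2 z ^ 2)
    (by positivity)
    ((hf.comp (by fun_prop : Continuous fun q : ℝ × ℝ => (q.1, q.2, z))).pow 2)

open Set in
theorem hmean_mul_eq_setIntegral {L : ℝ} (hL : 0 ≤ L) {f g : ℝ → ℝ → ℝ → ℝ}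
    (hf : Continuous fun p : ℝ × ℝ × ℝ => f p.1 p.2.1 p.2.2)
    (hg : Continuous fun p : ℝ × ℝ × ℝ => g p.1 p.2.1 p.2.2) (z : ℝ) :
    hmean L (fun x y z' => f x y z' * g x y z') z = (1/(4*π^2*L^2)) *
      ∫ p in Icc 0 (2*π*L) ×ˢ Icc 0 (2*π*L), f p.2 p.1 z * g p.2 p.1 z := by
  unfold hmean
  congr 1
  have hz : Continuous fun q : ℝ × ℝ => (q.1, q.2, z) := by fun_prop
  exact intervalIntegral_intervalIntegral_eq_setIntegral
    (w := fun q => f q.1 q.2 z * g q.1 q.2 z) (by positivity) ((hf.comp hz).mul (hg.comp hz))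

/-- Estimate for the vertical derivative of the horizontal mean of a product. -/
theorem dz_mean_product_estimate (L : ℝ) (hL : 0 < L) :
    ∃ C : ℝ, 0 < C ∧ ∀ f g : ℝ → ℝ → ℝ → ℝ,
      Smooth3 f → OmegaPeriodic L f → Smooth3 g → OmegaPeriodic L g →
      (∫ z in (0:ℝ)..(2*π),
          (deriv (fun s => hmean L (fun x y z' => f x y z' * g x y z') s) z)^2)
        ≤ C * ((l2sq L g + l2sq L (fun x y z => pdz g x y z)) * l2sq L (fun x y z => pdz f x y z)
             + (l2sq L f + l2sq L (fun x y z => pdz f x y z)) * l2sq L (fun x y z => pdz g x y z)) := by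
  refine ⟨(1/(4*π^2*L^2))^2 * 4, by positivity, fun f g hf _ hg _ => ?_⟩
  have hfc := ContDiff.continuous hf
  have hgc := ContDiff.continuous hg
  have hr : Continuous fun q : ℝ × ℝ × ℝ => (q.2.2, q.2.1, q.1) := by fun_prop
  have hT : (1:ℝ) ≤ 2 * π := by linarith [Real.pi_gt_three]
  have h := integral_sq_deriv_setIntegral_mul_le
    ((isCompact_Icc (a := 0) (b := 2*π*L)).prod (isCompact_Icc (a := 0) (b := 2*π*L))) hT
    (u := fun z p => f p.2 p.1 z) (u' := fun z p => pdz f p.2 p.1 z)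
    (v := fun z p => g p.2 p.1 z) (v' := fun z p => pdz g p.2 p.1 z)
    (hfc.comp hr) (hf.continuous_pdz.comp hr) (hgc.comp hr) (hg.continuous_pdz.comp hr)
    (fun z p => hf.hasDerivAt_pdz _ _ z) (fun z p => hg.hasDerivAt_pdz _ _ z)
  rw [l2sq_eq_integral_setIntegral hL.le hfc, l2sq_eq_integral_setIntegral hL.le hgc,
    l2sq_eq_integral_setIntegral hL.le hf.continuous_pdz,
    l2sq_eq_integral_setIntegral hL.le hg.continuous_pdz]
  simp only [hmean_mul_eq_setIntegral hL.le hfc hgc]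
  generalize 1/(4*π^2*L^2) = c
  simp only [deriv_const_mul_field, mul_pow,
    intervalIntegral.integral_const_mul]
  rw [mul_assoc (c ^ 2)]
  exact mul_le_mul_of_nonneg_left h (sq_nonneg _)
end
end
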